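/- Let n ≥ 3 and f₁, …, fₙ be univariate polynomials over ℂ, not all constant, with f₁ + ⋯ + fₙ = 0, such that every vanishing subsum f_{i₁} + ⋯ + f_{i_s} = 0 satisfies gcd{f_{i₁}, …, f_{i_s}} = 1. Then max₁≤m≤n deg fₘ ≤ ((n−1)(n−2)/2)·(r(f₁f₂⋯fₙ) − 1). -/

import Mathlib

open Polynomial

/-- `rdeg g` = number of distinct complex roots of `g` (degree of its radical). -/
noncomputable def rdeg (g : ℂ[X]) : ℕ := g.roots.toFinset.card

/-- Wronskian determinant of a tuple of polynomials. -/
noncomputable def wr {l : ℕ} (u : Fin l → ℂ[X]) : ℂ[X] :=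
  (Matrix.of fun i j : Fin l => derivative^[(j : ℕ)] (u i)).det

lemma prop_natDegree (a b : ℂ[X]) (ha : a ≠ 0) (hb : b ≠ 0)
    (h : a * derivative b = derivative a * b) : a.natDegree = b.natDegree := by
  by_cases ha' : a.natDegree = 0
  · have : derivative a = 0 := derivative_of_natDegree_zero ha'
    rw [this, zero_mul] at h
    have hb' := (mul_eq_zero.mp h).resolve_left ha
    rw [ha', derivative_eq_zero.mp hb']
  by_cases hb' : b.natDegree = 0
  · have : derivative b = 0 := derivative_of_natDegree_zero hb'
    rw [this, mul_zero] at h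
    have hb' := (mul_eq_zero.mp h.symm).resolve_right hb
    exact absurd (derivative_eq_zero.mp hb') ha'
  have h1 := congrArg leadingCoeff h
  rw [leadingCoeff_mul, leadingCoeff_mul] at h1
  have key : ∀ p : ℂ[X], p.natDegree ≠ 0 →
      (derivative p).leadingCoeff = p.leadingCoeff * p.natDegree := by
    intro p hp
    rw [leadingCoeff, natDegree_derivative, coeff_derivative, leadingCoeff]
    have : p.natDegree - 1 + 1 = p.natDegree := by omega
    rw [this]
    congr 1
    rw [← this]; push_cast; simp
  rw [key a ha', key b hb'] at h1
  have ha1 : a.leadingCoeff ≠ 0 := leadingCoeff_ne_zero.mpr ha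
  have hb1 : b.leadingCoeff ≠ 0 := leadingCoeff_ne_zero.mpr hb
  have : (b.natDegree : ℂ) = a.natDegree := by
    apply mul_left_cancel₀ (mul_ne_zero ha1 hb1)
    linear_combination h1
  exact_mod_cast this.symm

lemma prop_const (a b : ℂ[X]) (ha : a ≠ 0)
    (h : a * derivative b = derivative a * b) : ∃ c : ℂ, b = C c * a := by
  by_cases hb : b = 0
  · exact ⟨0, by simp [hb]⟩
  have hd := prop_natDegree a b ha hb h
  have ha1 : a.leadingCoeff ≠ 0 := leadingCoeff_ne_zero.mpr ha
  set c := b.leadingCoeff / a.leadingCoeff with hc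
  refine ⟨c, ?_⟩
  by_contra hne
  have h0 : b - C c * a ≠ 0 := sub_ne_zero.mpr hne
  have h2 : a * derivative (b - C c * a) = derivative a * (b - C c * a) := by
    simp only [derivative_sub, derivative_C_mul]
    linear_combination h
  have hd2 := prop_natDegree a _ ha h0 h2
  have : (b - C c * a).coeff a.natDegree = 0 := by
    rw [coeff_sub, coeff_C_mul]
    conv_lhs => enter [1]; rw [hd]
    change b.leadingCoeff - c * a.leadingCoeff = 0
    rw [hc]; field_simp; ring
  rw [hd2] at this
  exact h0 (leadingCoeff_eq_zero.mp this)

lemma wr_ne_zero : ∀ (l : ℕ) (u : Fin l → ℂ[X]), LinearIndependent ℂ u → wr u ≠ 0 := by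
  intro l
  induction l with
  | zero => intro u _; simp [wr]
  | succ l ih =>
    intro u hu h0
    have hu' : LinearIndependent ℂ (fun i : Fin l => u i.castSucc) :=
      hu.comp Fin.castSucc (Fin.castSucc_injective l)
    have hW := ih _ hu'
    obtain ⟨a, ha, hM⟩ := Matrix.exists_vecMul_eq_zero_iff.mpr h0
    have hrel : ∀ j : ℕ, j < l + 1 →
        ∑ i : Fin l, a i.castSucc * derivative^[j] (u i.castSucc)
          + a (Fin.last l) * derivative^[j] (u (Fin.last l)) = 0 := by
      intro j hj
      have := congrFun hM ⟨j, hj⟩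
      simp only [Matrix.vecMul, dotProduct, Matrix.of_apply, Pi.zero_apply] at this
      rw [Fin.sum_univ_castSucc] at this
      exact this
    have hker : ∀ b : Fin l → ℂ[X],
        (∀ j : ℕ, j < l → ∑ i : Fin l, b i * derivative^[j] (u i.castSucc) = 0) → b = 0 := by
      intro b hb
      apply Matrix.eq_zero_of_vecMul_eq_zero hW
      funext j
      simpa [Matrix.vecMul, dotProduct] using hb j j.2
    have hlast : a (Fin.last l) ≠ 0 := by
      intro hl
      apply ha
      have := hker (fun i => a i.castSucc) (by
        intro j hj
        have := hrel j (by omega)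
        simpa [hl] using this)
      funext i
      refine Fin.lastCases ?_ (fun i => ?_) i
      · exact hl
      · exact congrFun this i
    have hb := hker (fun i => a (Fin.last l) * derivative (a i.castSucc)
        - derivative (a (Fin.last l)) * a i.castSucc) (by
      intro j hj
      have h1 := hrel j (by omega)
      have h2 := hrel (j+1) (by omega)
      have h3 := congrArg derivative h1
      simp only [derivative_add, derivative_sum, derivative_mul, ← Function.iterate_succ_apply',
        Finset.sum_add_distrib, derivative_zero] at h3
      simp only [sub_mul, Finset.sum_sub_distrib, mul_assoc, ← Finset.mul_sum]
      simp only [Nat.succ_eq_add_one] at h3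
      linear_combination a (Fin.last l) * h3 - a (Fin.last l) * h2
        - derivative (a (Fin.last l)) * h1)
    have hc : ∀ i : Fin l, ∃ c : ℂ, a i.castSucc = C c * a (Fin.last l) := fun i =>
      prop_const _ _ hlast (sub_eq_zero.mp (congrFun hb i))
    choose c hc using hc
    have h1 := hrel 0 (by omega)
    simp only [Function.iterate_zero, id, hc] at h1
    have h2 : a (Fin.last l) * (∑ i : Fin l, C (c i) * u i.castSucc + u (Fin.last l)) = 0 := by
      rw [← h1, mul_add, Finset.mul_sum]
      congr 1
      exact Finset.sum_congr rfl fun i _ => by ring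
    have h3 := (mul_eq_zero.mp h2).resolve_left hlast
    have h4 := Fintype.linearIndependent_iff.mp hu (Fin.snoc c 1) (by
      rw [Fin.sum_univ_castSucc]
      simpa [smul_eq_C_mul] using h3) (Fin.last l)
    simp at h4

lemma wr_update {l : ℕ} (u : Fin l → ℂ[X]) (c : Fin l → ℂ) (i : Fin l) :
    wr (Function.update u i (∑ k, C (c k) * u k)) = C (c i) * wr u := by
  unfold wr
  rw [← smul_eq_mul, ← Matrix.det_updateRow_sum _ i (fun k => C (c k))]
  congr 1
  ext1 a b
  by_cases h : a = i
  · subst h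
    simp [iterate_derivative_sum, iterate_derivative_C_mul, Finset.sum_apply]
  · simp [h]

lemma wr_natDegree {l : ℕ} (u : Fin l → ℂ[X]) (h : wr u ≠ 0) :
    (wr u).natDegree + ∑ i : Fin l, (i : ℕ) ≤ ∑ i, (u i).natDegree := by
  have hterm : ∀ σ : Equiv.Perm (Fin l),
      (∏ i : Fin l, derivative^[(i : ℕ)] (u (σ i))) ≠ 0 →
      (∏ i : Fin l, derivative^[(i : ℕ)] (u (σ i))).natDegree + ∑ i : Fin l, (i : ℕ)
        ≤ ∑ i, (u i).natDegree := by
    intro σ hσ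
    have h1 := Finset.prod_ne_zero_iff.mp hσ
    rw [natDegree_prod _ _ h1, ← Finset.sum_add_distrib,
      ← Equiv.sum_comp σ (fun i => (u i).natDegree)]
    apply Finset.sum_le_sum
    intro i _
    have h2 := natDegree_iterate_derivative (u (σ i)) i
    have h3 : ¬ (u (σ i)).natDegree < i := fun h => h1 i (Finset.mem_univ _)
      (iterate_derivative_eq_zero h)
    omega
  have hle : ∑ i : Fin l, (i : ℕ) ≤ ∑ i, (u i).natDegree := by
    unfold wr at h
    rw [Matrix.det_apply] at h
    obtain ⟨σ, _, hσ⟩ := Finset.exists_ne_zero_of_sum_ne_zero h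
    have := hterm σ (by intro h0; apply hσ; simp [h0])
    omega
  suffices (wr u).natDegree ≤ ∑ i, (u i).natDegree - ∑ i : Fin l, (i : ℕ) by omega
  unfold wr
  rw [Matrix.det_apply]
  apply natDegree_sum_le_of_forall_le
  intro σ _
  simp only [Matrix.of_apply]
  by_cases h0 : (∏ i : Fin l, derivative^[(i : ℕ)] (u (σ i))) = 0
  · simp [h0]
  · have := hterm σ h0
    rcases Int.units_eq_one_or (Equiv.Perm.sign σ) with h | h <;> simp [h] <;> omega

lemma wr_rootMultiplicity {l : ℕ} (u : Fin l → ℂ[X]) (h : wr u ≠ 0) (α : ℂ) :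
    ∑ i, (u i).rootMultiplicity α ≤ (wr u).rootMultiplicity α + ∑ i : Fin l, (i : ℕ) := by
  suffices ∑ i, (u i).rootMultiplicity α - ∑ i : Fin l, (i : ℕ) ≤ (wr u).rootMultiplicity α by
    omega
  rw [le_rootMultiplicity_iff h]
  unfold wr
  rw [Matrix.det_apply]
  apply Finset.dvd_sum
  intro σ _
  have hd : (X - C α) ^ (∑ i, (u i).rootMultiplicity α - ∑ i : Fin l, (i : ℕ)) ∣
      ∏ i : Fin l, derivative^[(i : ℕ)] (u (σ i)) := by
    refine dvd_trans (pow_dvd_pow _ (n := ∑ i : Fin l, ((u (σ i)).rootMultiplicity α - i)) ?_) ?_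
    · rw [← Equiv.sum_comp σ, tsub_le_iff_right, ← Finset.sum_add_distrib]
      apply Finset.sum_le_sum
      intro i _
      omega
    · rw [← Finset.prod_pow_eq_pow_sum]
      apply Finset.prod_dvd_prod_of_dvd
      intro i _
      exact pow_sub_dvd_iterate_derivative_of_pow_dvd _ (pow_rootMultiplicity_dvd _ _)
  rcases Int.units_eq_one_or (Equiv.Perm.sign σ) with h | h <;> simpa [h] using hd

lemma sum_rootMultiplicity_le (p : ℂ[X]) (R : Finset ℂ) :
    ∑ α ∈ R, p.rootMultiplicity α ≤ p.natDegree := by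
  simp only [← count_roots]
  calc ∑ α ∈ R, p.roots.count α ≤ ∑ α ∈ R ∪ p.roots.toFinset, p.roots.count α :=
        Finset.sum_le_sum_of_subset Finset.subset_union_left
    _ = p.roots.card := by
        rw [Multiset.sum_count_eq_card]
        intro a ha
        simp [Multiset.mem_toFinset.mpr ha]
    _ ≤ p.natDegree := card_roots' p

lemma sum_rootMultiplicity_eq (p : ℂ[X]) (R : Finset ℂ) (h : ∀ α ∈ p.roots, α ∈ R) :
    ∑ α ∈ R, p.rootMultiplicity α = p.natDegree := by
  simp only [← count_roots]
  rw [Multiset.sum_count_eq_card h]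
  exact splits_iff_card_roots.mp (IsAlgClosed.splits p)

lemma core {l : ℕ} (u : Fin l → ℂ[X]) (hu : LinearIndependent ℂ u) (R : Finset ℂ)
    (hR : ∀ i, ∀ α ∈ (u i).roots, α ∈ R) (c : Fin l → ℂ) (hc : ∀ i, c i ≠ 0) (g : ℂ[X])
    (hg : g = ∑ i, C (c i) * u i) :
    ∃ (e : ℂ → ℤ) (E : ℤ), (∀ α, 0 ≤ e α) ∧ 0 ≤ E ∧
      (∀ i α, (g.rootMultiplicity α : ℤ) ≤ (u i).rootMultiplicity α + e α) ∧
      (∀ i, ((u i).natDegree : ℤ) ≤ g.natDegree + E) ∧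
      2 * (∑ α ∈ R, e α + E) ≤ l * ((l : ℤ) - 1) * ((R.card : ℤ) - 1) := by
  have hW := wr_ne_zero l u hu
  obtain ⟨T, hT⟩ : ∃ T : ℕ, T = ∑ i : Fin l, (i : ℕ) := ⟨_, rfl⟩
  have hT2 : (2 : ℤ) * T = l * ((l : ℤ) - 1) := by
    have h1 : T * 2 = l * (l - 1) := by
      rw [hT, Fin.sum_univ_eq_sum_range (fun i => i) l, Finset.sum_range_id_mul_two]
    rcases l with _ | l
    · simp at h1; simp [h1]
    · simp at h1; push_cast; zify at h1; linarith
  have hupd : ∀ i, wr (Function.update u i g) = C (c i) * wr u := by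
    intro i; rw [hg, wr_update]
  have hupd0 : ∀ i, wr (Function.update u i g) ≠ 0 := by
    intro i; rw [hupd]; exact mul_ne_zero (by simpa using hc i) hW
  have hs : ∀ (F : ℂ[X] → ℕ) (i : Fin l),
      ∑ k, F (Function.update u i g k) + F (u i) = ∑ k, F (u k) + F g := by
    intro F i
    rw [← Finset.add_sum_erase _ _ (Finset.mem_univ i),
      ← Finset.add_sum_erase (f := fun k => F (u k)) _ (Finset.mem_univ i)]
    have : ∑ k ∈ Finset.univ.erase i, F (Function.update u i g k)
        = ∑ k ∈ Finset.univ.erase i, F (u k) := by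
      apply Finset.sum_congr rfl
      intro k hk
      rw [Function.update_of_ne (Finset.ne_of_mem_erase hk)]
    rw [this]; simp; ring
  refine ⟨fun α => (wr u).rootMultiplicity α + T - ∑ k, ((u k).rootMultiplicity α : ℤ),
    ∑ k, ((u k).natDegree : ℤ) - T - (wr u).natDegree, ?_, ?_, ?_, ?_, ?_⟩
  · intro α
    have := wr_rootMultiplicity u hW α
    rw [← hT] at this
    zify at this
    dsimp only; linarith
  · have := wr_natDegree u hW
    rw [← hT] at this
    zify at this
    linarith
  · intro i α
    have h1 := wr_rootMultiplicity _ (hupd0 i) α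
    have h2 := hs (fun p => p.rootMultiplicity α) i
    have h3 : (C (c i) * wr u).rootMultiplicity α = (wr u).rootMultiplicity α := by
      rw [← count_roots, roots_C_mul _ (hc i), count_roots]
    rw [hupd, h3, ← hT] at h1
    zify at h1 h2
    dsimp only; linarith
  · intro i
    have h1 := wr_natDegree _ (hupd0 i)
    have h2 := hs (fun p => p.natDegree) i
    rw [hupd, natDegree_C_mul (hc i), ← hT] at h1
    zify at h1 h2
    linarith
  · have h1 : ∑ α ∈ R, ∑ k, ((u k).rootMultiplicity α : ℤ) = ∑ k, ((u k).natDegree : ℤ) := by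
      rw [Finset.sum_comm]
      apply Finset.sum_congr rfl
      intro k _
      exact_mod_cast sum_rootMultiplicity_eq (u k) R (hR k)
    have h2 := sum_rootMultiplicity_le (wr u) R
    zify at h2
    rw [Finset.sum_sub_distrib, Finset.sum_add_distrib, h1, Finset.sum_const, nsmul_eq_mul, ← hT2]
    linarith

lemma exists_indep {ι : Type*} [DecidableEq ι] (f : ι → ℂ[X]) (V : Submodule ℂ ℂ[X]) :
    ∀ (B : Finset ι) (c : ι → ℂ), ∑ i ∈ B, c i • f i ∈ V → ∑ i ∈ B, c i • f i ≠ 0 →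
    ∃ L ⊆ B, ∃ c : ι → ℂ, (∀ i ∈ L, c i ≠ 0) ∧ ∑ i ∈ L, c i • f i ∈ V ∧
      ∑ i ∈ L, c i • f i ≠ 0 ∧ LinearIndepOn ℂ f (L : Set ι) := by
  intro B
  induction B using Finset.strongInduction with
  | H B ih =>
    intro c hV h0
    have hred : ∀ (c : ι → ℂ) (j : ι), j ∈ B → c j = 0 → ∑ i ∈ B, c i • f i ∈ V →
        ∑ i ∈ B, c i • f i ≠ 0 → ∃ L ⊆ B, ∃ c : ι → ℂ, (∀ i ∈ L, c i ≠ 0) ∧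
        ∑ i ∈ L, c i • f i ∈ V ∧
        ∑ i ∈ L, c i • f i ≠ 0 ∧ LinearIndepOn ℂ f (L : Set ι) := by
      intro c j hj hcj hV h0
      have he : ∑ i ∈ B.erase j, c i • f i = ∑ i ∈ B, c i • f i := by
        apply Finset.sum_erase; simp [hcj]
      rw [← he] at hV h0
      obtain ⟨L, hL, h⟩ := ih (B.erase j) (Finset.erase_ssubset hj) c hV h0
      exact ⟨L, hL.trans (Finset.erase_subset _ _), h⟩
    by_cases hz : ∃ j ∈ B, c j = 0
    · obtain ⟨j, hj, hcj⟩ := hz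
      exact hred c j hj hcj hV h0
    push Not at hz
    by_cases hli : LinearIndepOn ℂ f (B : Set ι)
    · exact ⟨B, subset_rfl, c, hz, hV, h0, hli⟩
    rw [linearIndepOn_finset_iff] at hli
    push Not at hli
    obtain ⟨d, hd, j, hj, hdj⟩ := hli
    have he : ∑ i ∈ B, (c i - c j / d j * d i) • f i = ∑ i ∈ B, c i • f i := by
      simp only [sub_smul, Finset.sum_sub_distrib, mul_smul, ← Finset.smul_sum, hd, smul_zero,
        sub_zero]
    refine hred (fun i => c i - c j / d j * d i) j hj (by field_simp; ring) ?_ ?_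
    · simpa only [he] using hV
    · simpa only [he] using h0

lemma grow {ι : Type*} [DecidableEq ι] (f : ι → ℂ[X]) (hf0 : ∀ i, f i ≠ 0) (R : Finset ℂ)
    (hR : ∀ i, ∀ α ∈ (f i).roots, α ∈ R) (hR1 : 1 ≤ R.card) (S : Finset ι)
    (hS : ∑ i ∈ S, f i = 0)
    (hmin : ∀ A ⊆ S, A.Nonempty → A ≠ S → ∑ i ∈ A, f i ≠ 0) :
    ∀ (N : ℕ) (A : Finset ι), (S \ A).card ≤ N → A ⊆ S → A.Nonempty → ∀ (μ : ℂ → ℤ) (D : ℤ),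
      (∀ i ∈ A, ∀ α, μ α ≤ (f i).rootMultiplicity α) → (∀ i ∈ A, ((f i).natDegree : ℤ) ≤ D) →
      2 * (D - ∑ α ∈ R, μ α) ≤ ((A.card : ℤ) - 1) * ((A.card : ℤ) - 2) * ((R.card : ℤ) - 1) →
    ∃ (μ : ℂ → ℤ) (D : ℤ),
      (∀ i ∈ S, ∀ α, μ α ≤ (f i).rootMultiplicity α) ∧ (∀ i ∈ S, ((f i).natDegree : ℤ) ≤ D) ∧
      2 * (D - ∑ α ∈ R, μ α) ≤ ((S.card : ℤ) - 1) * ((S.card : ℤ) - 2) * ((R.card : ℤ) - 1) := by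
  intro N
  induction N with
  | zero =>
    intro A hA hAS _ μ D h1 h2 h3
    have : A = S := by
      apply Finset.Subset.antisymm hAS
      rw [← Finset.sdiff_eq_empty_iff_subset, ← Finset.card_eq_zero]; omega
    subst this
    exact ⟨μ, D, h1, h2, h3⟩
  | succ N ih =>
    intro A hA hAS hAne μ D h1 h2 h3
    by_cases hAeq : A = S
    · subst hAeq
      exact ⟨μ, D, h1, h2, h3⟩
    have hAsum := hmin A hAS hAne hAeq
    have hsplit := Finset.sum_sdiff (f := f) hAS
    rw [hS] at hsplit
    let V := Submodule.span ℂ (f '' (A : Set ι))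
    have hBeq : ∑ i ∈ S \ A, (1 : ℂ) • f i = - ∑ i ∈ A, f i := by
      simp only [one_smul]; exact eq_neg_of_add_eq_zero_left hsplit
    obtain ⟨L, hLB, c, hc, hV, hg0, hli⟩ := exists_indep f V (S \ A) (fun _ => 1)
      (by
        rw [hBeq]
        exact V.neg_mem (V.sum_mem fun i hi => Submodule.subset_span ⟨i, hi, rfl⟩))
      (by rw [hBeq]; exact neg_ne_zero.mpr hAsum)
    set g := ∑ i ∈ L, c i • f i with hg
    have hgm : ∀ α, μ α ≤ g.rootMultiplicity α := by
      intro α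
      have hdv : ∀ x ∈ V, (X - C α) ^ (μ α).toNat ∣ x := by
        intro x hx
        refine Submodule.span_induction ?_ ?_ ?_ ?_ hx
        · rintro _ ⟨i, hi, rfl⟩
          rw [← le_rootMultiplicity_iff (hf0 i)]
          have := h1 i hi α
          omega
        · exact dvd_zero _
        · intro x y _ _ hx hy; exact dvd_add hx hy
        · intro a x _ hx; exact hx.trans (by rw [smul_eq_C_mul]; exact dvd_mul_left _ _)
      have := (le_rootMultiplicity_iff hg0).mpr (hdv g hV)
      omega
    have hgd : (g.natDegree : ℤ) ≤ D := by
      have hdv : ∀ x ∈ V, (x.natDegree : ℤ) ≤ D := by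
        have hD0 : 0 ≤ D := by
          obtain ⟨i, hi⟩ := hAne
          have := h2 i hi
          omega
        intro x hx
        refine Submodule.span_induction ?_ ?_ ?_ ?_ hx
        · rintro _ ⟨i, hi, rfl⟩
          exact h2 i hi
        · simpa using hD0
        · intro x y _ _ hx hy
          have := natDegree_add_le x y
          omega
        · intro a x _ hx
          have := natDegree_smul_le a x
          omega
      exact hdv g hV
    let q := L.equivFin.symm
    obtain ⟨e, E, he0, hE0, he, hE, hsum⟩ := core (fun k : Fin L.card => f (q k))
      (by
        have : LinearIndependent ℂ (fun i : L => f i) := hli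
        exact this.comp q q.injective)
      R (fun k => hR _) (fun k => c (q k)) (fun k => hc _ (q k).2) g
      (by
        rw [hg, Equiv.sum_comp q (fun i : L => C (c i) * f i),
          Finset.sum_coe_sort L (fun i => C (c i) * f i)]
        simp only [smul_eq_C_mul])
    have heL : ∀ i ∈ L, ∀ α, (g.rootMultiplicity α : ℤ) ≤ (f i).rootMultiplicity α + e α := by
      intro i hi α
      simpa using he (q.symm ⟨i, hi⟩) α
    have hEL : ∀ i ∈ L, ((f i).natDegree : ℤ) ≤ g.natDegree + E := by
      intro i hi
      simpa using hE (q.symm ⟨i, hi⟩)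
    have hLne : L.Nonempty := by
      rw [Finset.nonempty_iff_ne_empty]
      rintro rfl
      exact hg0 (by simp [hg])
    have hdisj : Disjoint A L := Finset.disjoint_of_subset_right hLB Finset.disjoint_sdiff
    have hcard := Finset.card_union_of_disjoint hdisj
    have hLS : L ⊆ S := hLB.trans Finset.sdiff_subset
    refine ih (A ∪ L) ?_ (Finset.union_subset hAS hLS) (hAne.mono Finset.subset_union_left)
      (fun α => μ α - e α) (D + E) ?_ ?_ ?_
    · have hlt : S \ (A ∪ L) ⊂ S \ A := by
        obtain ⟨x, hx⟩ := hLne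
        refine Finset.ssubset_iff_of_subset
          (Finset.sdiff_subset_sdiff subset_rfl Finset.subset_union_left) |>.mpr ⟨x, hLB hx, ?_⟩
        simp [hx]
      have := Finset.card_lt_card hlt
      omega
    · intro i hi α
      have h5 := he0 α
      have h6 := hgm α
      rcases Finset.mem_union.mp hi with hi | hi
      · have := h1 i hi α
        omega
      · have := heL i hi α
        omega
    · intro i hi
      rcases Finset.mem_union.mp hi with hi | hi
      · have := h2 i hi
        omega
      · have := hEL i hi
        omega
    · rw [hcard, Finset.sum_sub_distrib]
      push_cast
      have ha : (1 : ℤ) ≤ A.card := by exact_mod_cast hAne.card_pos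
      have hr : (1 : ℤ) ≤ R.card := by exact_mod_cast hR1
      have hl : (0 : ℤ) ≤ L.card := by positivity
      have h7 : 0 ≤ (L.card : ℤ) * ((A.card : ℤ) - 1) * ((R.card : ℤ) - 1) :=
        mul_nonneg (mul_nonneg hl (by linarith)) (by linarith)
      nlinarith [h7, hsum, h3]

theorem stmt5 (n : ℕ) (hn : 3 ≤ n) (f : Fin n → ℂ[X])
    (hconst : ¬ ∀ i, (f i).natDegree = 0)
    (hsum : ∑ i, f i = 0)
    (hgcd : ∀ S : Finset (Fin n), S.Nonempty → (∑ i ∈ S, f i) = 0 →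
      ∀ p : ℂ[X], (∀ i ∈ S, p ∣ f i) → IsUnit p) :
    ∀ m, ((f m).natDegree : ℚ) ≤
      (((n : ℚ) - 1) * ((n : ℚ) - 2) / 2) * ((rdeg (∏ i, f i) : ℚ) - 1) := by
  intro m
  have hf0 : ∀ i, f i ≠ 0 := by
    intro i hi
    have := hgcd {i} (by simp) (by simpa using hi) 0 (by simp [hi])
    simp at this
  have hP : ∏ i, f i ≠ 0 := Finset.prod_ne_zero_iff.mpr fun i _ => hf0 i
  obtain ⟨R, hRdef⟩ : ∃ R, R = (∏ i, f i).roots.toFinset := ⟨_, rfl⟩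
  have hR : ∀ i, ∀ α ∈ (f i).roots, α ∈ R := by
    intro i α hα
    rw [hRdef, Multiset.mem_toFinset]
    exact Multiset.mem_of_le (roots.le_of_dvd hP (Finset.dvd_prod_of_mem f (Finset.mem_univ i))) hα
  have hR1 : 1 ≤ R.card := by
    push Not at hconst
    obtain ⟨i, hi⟩ := hconst
    have h1 := splits_iff_card_roots.mp (IsAlgClosed.splits (f i))
    obtain ⟨α, hα⟩ := Multiset.card_pos_iff_exists_mem.mp (by omega : 0 < (f i).roots.card)
    exact Finset.card_pos.mpr ⟨α, hR i α hα⟩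
  have hrd : rdeg (∏ i, f i) = R.card := by rw [hRdef, rdeg]
  rw [hrd]
  -- minimal vanishing subsum containing m
  obtain ⟨S, hSmem, hSmin⟩ := Finset.exists_min_image
    (Finset.univ.filter fun S : Finset (Fin n) => m ∈ S ∧ ∑ i ∈ S, f i = 0) Finset.card
    ⟨Finset.univ, by simp [hsum]⟩
  simp only [Finset.mem_filter, Finset.mem_univ, true_and] at hSmem hSmin
  obtain ⟨hmS, hS0⟩ := hSmem
  have hmin : ∀ A ⊆ S, A.Nonempty → A ≠ S → ∑ i ∈ A, f i ≠ 0 := by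
    intro A hAS hAne hAeq hA0
    by_cases hmA : m ∈ A
    · have := hSmin A ⟨hmA, hA0⟩
      exact hAeq (Finset.eq_of_subset_of_card_le hAS this)
    · have h1 := Finset.sum_sdiff (f := f) hAS
      rw [hA0, hS0, add_zero] at h1
      have := hSmin (S \ A) ⟨by simp [hmS, hmA], h1⟩
      have h2 := Finset.card_sdiff_add_card_eq_card hAS
      have := hAne.card_pos
      omega
  obtain ⟨μ, D, h1, h2, h3⟩ := grow f hf0 R hR hR1 S hS0 hmin _ {m} le_rfl (by simpa using hmS)
    (by simp) (fun α => (f m).rootMultiplicity α) (f m).natDegree (by simp) (by simp)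
    (by
      have : ∑ α ∈ R, ((f m).rootMultiplicity α : ℤ) = (f m).natDegree := by
        exact_mod_cast sum_rootMultiplicity_eq (f m) R (hR m)
      rw [this]; simp)
  have hμ : ∀ α, μ α ≤ 0 := by
    intro α
    by_contra hpos
    push Not at hpos
    have := hgcd S ⟨m, hmS⟩ hS0 (X - C α) (by
      intro i hi
      have := h1 i hi α
      rw [dvd_iff_isRoot, ← rootMultiplicity_pos (hf0 i)]
      omega)
    exact not_isUnit_X_sub_C α this
  have h4 : ∑ α ∈ R, μ α ≤ 0 := Finset.sum_nonpos fun α _ => hμ α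
  have h5 := h2 m hmS
  have hs1 : 1 ≤ S.card := Finset.card_pos.mpr ⟨m, hmS⟩
  have hsn : S.card ≤ n := by simpa using Finset.card_le_univ S
  have h6 : ((S.card : ℤ) - 1) * ((S.card : ℤ) - 2) ≤ ((n : ℤ) - 1) * ((n : ℤ) - 2) := by
    zify at hs1 hsn hn
    nlinarith
  have hr : (0 : ℤ) ≤ (R.card : ℤ) - 1 := by omega
  have h7 := mul_le_mul_of_nonneg_right h6 hr
  have h8 : 2 * ((f m).natDegree : ℤ) ≤ ((n : ℤ) - 1) * ((n : ℤ) - 2) * ((R.card : ℤ) - 1) := by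
    linarith
  have h9 : 2 * ((f m).natDegree : ℚ) ≤ ((n : ℚ) - 1) * ((n : ℚ) - 2) * ((R.card : ℚ) - 1) := by
    exact_mod_cast h8
  linarith
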